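/- arXiv:1808.03146 — 2 statements merged into one kernel-verified Lean document; each statement's English description precedes it below -/
import Mathlib

section
/- Let L be a field, V and V' finite-dimensional L-vector spaces with L-linear endomorphisms φ : V → V and φ' : V' → V'. Let ⊥ = W_{-1} ≤ W_0 ≤ ⋯ ≤ W_n = ⊤ be a chain of φ-invariant subspaces of V and ⊥ = W'_{-1} ≤ W'_0 ≤ ⋯ ≤ W'_n = ⊤ a chain of φ'-invariant subspaces of V'. Let P_k (resp. P'_j) be the characteristic polynomial of the endomorphism induced by φ on W_k/W_{k-1} (resp. by φ' on W'_j/W'_{j-1}), and assume P_k and P'_j are coprime in L[X] whenever k ≠ j. Then every L-linear map f : V → V' with f ∘ φ = φ' ∘ f satisfies f(W_k) ⊆ W'_k for all k; that is, f is automatically compatible with the filtrations. -/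
/-- The endomorphism induced by `φ` on the graded piece `B ⧸ A` of a pair of nested
`φ`-invariant subspaces `A ≤ B`. -/
noncomputable def gradedEnd {L V : Type*} [Field L] [AddCommGroup V] [Module L V]
    (φ : V →ₗ[L] V) (A B : Submodule L V)
    (hA : ∀ x ∈ A, φ x ∈ A) (hB : ∀ x ∈ B, φ x ∈ B) :
    (B ⧸ A.comap B.subtype) →ₗ[L] (B ⧸ A.comap B.subtype) :=
  Submodule.mapQ _ _ (φ.restrict hB) (fun x hx => hA x.1 hx)

/-- The characteristic polynomial of the endomorphism induced by `φ` on the graded piece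
`B ⧸ A` of a pair of nested `φ`-invariant subspaces `A ≤ B`. -/
noncomputable def gradedCharpoly {L V : Type*} [Field L] [AddCommGroup V] [Module L V]
    [FiniteDimensional L V] (φ : V →ₗ[L] V) (A B : Submodule L V)
    (hA : ∀ x ∈ A, φ x ∈ A) (hB : ∀ x ∈ B, φ x ∈ B) : Polynomial L :=
  LinearMap.charpoly (gradedEnd φ A B hA hB)

theorem LinearMap.map_aeval_apply_of_comp_eq {R M N : Type*} [CommSemiring R]
    [AddCommMonoid M] [Module R M] [AddCommMonoid N] [Module R N]
    {φ : M →ₗ[R] M} {ψ : N →ₗ[R] N} {f : M →ₗ[R] N} (hf : f ∘ₗ φ = ψ ∘ₗ f)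
    (p : Polynomial R) (x : M) :
    f (Polynomial.aeval φ p x) = Polynomial.aeval ψ p (f x) := by
  induction p using Polynomial.induction_on' generalizing x with
  | add p q hp hq => simp [hp, hq]
  | monomial n a =>
    have hx : f ((φ ^ n) x) = (ψ ^ n) (f x) :=
      (LinearMap.congr_fun (Module.End.commute_pow_left_of_commute hf.symm n) x).symm
    simp [Polynomial.aeval_monomial, Module.algebraMap_end_apply, hx]

theorem aeval_gradedCharpoly_apply_mem {L V : Type*} [Field L] [AddCommGroup V] [Module L V]
    [FiniteDimensional L V] (φ : V →ₗ[L] V) (A B : Submodule L V)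
    (hA : ∀ x ∈ A, φ x ∈ A) (hB : ∀ x ∈ B, φ x ∈ B) {x : V} (hx : x ∈ B) :
    Polynomial.aeval φ (gradedCharpoly φ A B hA hB) x ∈ A := by
  set p := gradedCharpoly φ A B hA hB
  let y : B := Polynomial.aeval (φ.restrict hB) p ⟨x, hx⟩
  have hy : (y : V) = Polynomial.aeval φ p x :=
    LinearMap.map_aeval_apply_of_comp_eq (f := B.subtype) (by ext; rfl) p ⟨x, hx⟩
  have hmk : (A.comap B.subtype).mkQ y = 0 := by
    rw [LinearMap.map_aeval_apply_of_comp_eq (ψ := gradedEnd φ A B hA hB) (by ext; rfl) p]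
    exact LinearMap.congr_fun (LinearMap.aeval_self_charpoly (gradedEnd φ A B hA hB)) _
  rw [← hy]
  simpa using hmk

/-- If `x ∈ B` is killed by `q(φ)` with `q` coprime to the characteristic polynomial of `φ` on
`B ⧸ A`, then `x ∈ A`. -/
theorem mem_of_aeval_eq_zero_of_isCoprime_gradedCharpoly {L V : Type*} [Field L]
    [AddCommGroup V] [Module L V] [FiniteDimensional L V] (φ : V →ₗ[L] V) (A B : Submodule L V)
    (hA : ∀ x ∈ A, φ x ∈ A) (hB : ∀ x ∈ B, φ x ∈ B) {q : Polynomial L}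
    (hq : IsCoprime q (gradedCharpoly φ A B hA hB)) {x : V} (hx : x ∈ B)
    (hqx : Polynomial.aeval φ q x = 0) : x ∈ A := by
  obtain ⟨a, b, hab⟩ := hq
  have hbx : Polynomial.aeval φ b x ∈ B :=
    Polynomial.aeval_apply_smul_mem_of_le_comap hx b φ hB
  have h := congrArg (fun r => Polynomial.aeval φ r x) hab
  rw [mul_comm b] at h
  simp only [map_add, map_mul, map_one, LinearMap.add_apply, Module.End.mul_apply, hqx, map_zero,
    zero_add, Module.End.one_apply] at h
  exact h ▸ aeval_gradedCharpoly_apply_mem φ A B hA hB hbx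

/-- A linear map intertwining `φ` and `φ'` is automatically compatible with filtrations by
invariant subspaces whose graded characteristic polynomials in distinct degrees are coprime.
(The filtrations `⊥ = W₋₁ ≤ W₀ ≤ ⋯ ≤ Wₙ = ⊤` are encoded with an index shift, so that `W k`
denotes `W_{k-1}`.) -/
theorem map_mem_filtration_of_comm_of_coprime_gradedCharpoly
    {L V V' : Type*} [Field L]
    [AddCommGroup V] [Module L V] [FiniteDimensional L V]
    [AddCommGroup V'] [Module L V'] [FiniteDimensional L V']
    (φ : V →ₗ[L] V) (φ' : V' →ₗ[L] V') (n : ℕ)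
    (W : ℕ → Submodule L V) (W' : ℕ → Submodule L V')
    (hbot : W 0 = ⊥) (htop : W (n + 1) = ⊤) (hmono : Monotone W)
    (hbot' : W' 0 = ⊥) (htop' : W' (n + 1) = ⊤) (hmono' : Monotone W')
    (hinv : ∀ k, ∀ x ∈ W k, φ x ∈ W k) (hinv' : ∀ k, ∀ x ∈ W' k, φ' x ∈ W' k)
    (P P' : ℕ → Polynomial L)
    (hP : ∀ k ≤ n, P k = gradedCharpoly φ (W k) (W (k + 1)) (hinv k) (hinv (k + 1)))
    (hP' : ∀ j ≤ n, P' j = gradedCharpoly φ' (W' j) (W' (j + 1)) (hinv' j) (hinv' (j + 1)))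
    (hcop : ∀ k ≤ n, ∀ j ≤ n, k ≠ j → IsCoprime (P k) (P' j))
    (f : V →ₗ[L] V') (hf : f ∘ₗ φ = φ' ∘ₗ f) :
    ∀ k ≤ n, (W (k + 1)).map f ≤ W' (k + 1) := by
  have hkill : ∀ k ≤ n + 1, ∀ x ∈ W k, Polynomial.aeval φ (∏ i ∈ Finset.range k, P i) x = 0 := by
    intro k
    induction k with
    | zero => simp [hbot]
    | succ k ih =>
      intro hk x hx
      rw [Finset.prod_range_succ, map_mul, Module.End.mul_apply, hP k (by omega)]
      exact ih (by omega) _ (aeval_gradedCharpoly_apply_mem φ _ _ _ _ hx)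
  rintro k hk _ ⟨x, hx, rfl⟩
  have hfx : Polynomial.aeval φ' (∏ i ∈ Finset.range (k + 1), P i) (f x) = 0 := by
    rw [← LinearMap.map_aeval_apply_of_comp_eq hf, hkill (k + 1) (by omega) x hx, map_zero]
  refine Nat.decreasingInduction' (P := fun j => f x ∈ W' j) (fun j hj hkj hmem => ?_)
    (Nat.succ_le_succ hk) (htop' ▸ Submodule.mem_top)
  refine mem_of_aeval_eq_zero_of_isCoprime_gradedCharpoly φ' _ _ (hinv' j) (hinv' (j + 1))
    ?_ hmem hfx
  rw [← hP' j (by omega)]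
  refine IsCoprime.prod_left fun i hi => ?_
  have := Finset.mem_range.mp hi
  exact hcop i (by omega) j (by omega) (by omega)
end

section
/- Let L be a field, V and V' finite-dimensional L-vector spaces with L-linear endomorphisms φ : V → V and φ' : V' → V'. Let ⊥ = W_{-1} ≤ W_0 ≤ ⋯ ≤ W_n = ⊤ be a chain of φ-invariant subspaces of V and ⊥ = W'_{-1} ≤ W'_0 ≤ ⋯ ≤ W'_n = ⊤ a chain of φ'-invariant subspaces of V'. Let P_k (resp. P'_j) be the characteristic polynomial of the endomorphism induced by φ on W_k/W_{k-1} (resp. by φ' on W'_j/W'_{j-1}), and assume P_k and P'_j are coprime in L[X] whenever k ≠ j. Then every L-linear map f : V → V' with f ∘ φ = φ' ∘ f is strictly compatible with the filtrations: for every k, the image of W_k under f equals range(f) ⊓ W'_k. -/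
open Polynomial in
/-- A linear map intertwining two endomorphisms intertwines every polynomial in them. -/
theorem map_aeval_of_comm {L V V' : Type*} [Field L] [AddCommGroup V] [Module L V]
    [AddCommGroup V'] [Module L V'] {φ : V →ₗ[L] V} {φ' : V' →ₗ[L] V'} {f : V →ₗ[L] V'}
    (hf : ∀ x, f (φ x) = φ' (f x)) (p : L[X]) (x : V) :
    f (aeval φ p x) = aeval φ' p (f x) := by
  induction p using Polynomial.induction_on' generalizing x with
  | add p q hp hq => simp [hp, hq]
  | monomial m a =>
    have hpow : f ((φ ^ m) x) = (φ' ^ m) (f x) := by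
      induction m generalizing x with
      | zero => simp
      | succ m ih => simp [pow_succ, ih, hf]
    simp [aeval_monomial, hpow]

open Polynomial in
/-- A polynomial in `φ` preserves every `φ`-invariant subspace. -/
theorem aeval_mem_of_invariant {L V : Type*} [Field L] [AddCommGroup V] [Module L V]
    {φ : V →ₗ[L] V} {B : Submodule L V} (hB : ∀ x ∈ B, φ x ∈ B) (p : L[X]) {x : V}
    (hx : x ∈ B) : aeval φ p x ∈ B := by
  have h := map_aeval_of_comm (φ := φ.restrict hB) (φ' := φ) (f := B.subtype)
    (fun _ => rfl) p ⟨x, hx⟩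
  exact h ▸ (aeval (φ.restrict hB) p ⟨x, hx⟩).2

open Polynomial in
/-- The graded characteristic polynomial of `B ⧸ A`, evaluated at `φ`, maps `B` into `A`. -/
theorem aeval_gradedCharpoly_mem {L V : Type*} [Field L] [AddCommGroup V] [Module L V]
    [FiniteDimensional L V] {φ : V →ₗ[L] V} {A B : Submodule L V}
    (hA : ∀ x ∈ A, φ x ∈ A) (hB : ∀ x ∈ B, φ x ∈ B) {x : V} (hx : x ∈ B) :
    aeval φ (gradedCharpoly φ A B hA hB) x ∈ A := by
  have hsub := map_aeval_of_comm (φ := φ.restrict hB) (φ' := φ) (f := B.subtype)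
    (fun _ => rfl) (gradedCharpoly φ A B hA hB) ⟨x, hx⟩
  have hquot := map_aeval_of_comm (φ := φ.restrict hB) (φ' := gradedEnd φ A B hA hB)
    (f := (A.comap B.subtype).mkQ) (fun _ => rfl) (gradedCharpoly φ A B hA hB) ⟨x, hx⟩
  have hzero : aeval (gradedEnd φ A B hA hB) (gradedCharpoly φ A B hA hB) = 0 :=
    LinearMap.aeval_self_charpoly _
  rw [hzero, LinearMap.zero_apply, Submodule.mkQ_apply, Submodule.Quotient.mk_eq_zero,
    Submodule.mem_comap, hsub] at hquot
  exact hquot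

open Polynomial in
/-- If each `P k` evaluated at `φ` maps `W (k + 1)` into `W k`, then the product of the `P k`
over `a ≤ k < b` maps `W b` into `W a`. -/
theorem aeval_prod_Ico_mem {L V : Type*} [Field L] [AddCommGroup V] [Module L V]
    {φ : V →ₗ[L] V} {W : ℕ → Submodule L V} {P : ℕ → L[X]} {a b : ℕ} (hab : a ≤ b)
    (hP : ∀ k < b, ∀ x ∈ W (k + 1), aeval φ (P k) x ∈ W k) {x : V} (hx : x ∈ W b) :
    aeval φ (∏ k ∈ Finset.Ico a b, P k) x ∈ W a := by
  induction b, hab using Nat.le_induction generalizing x with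
  | base => simpa using hx
  | succ b hab ih =>
    rw [Finset.prod_Ico_succ_top hab, map_mul, Module.End.mul_apply]
    exact ih (fun k hk => hP k (by lia)) (hP b (by lia) x hx)

/-- A linear map intertwining `φ` and `φ'` is automatically strictly compatible with filtrations
by invariant subspaces whose graded characteristic polynomials in distinct degrees are coprime:
`f (W_k) = range f ⊓ W'_k`. (The filtrations `⊥ = W₋₁ ≤ W₀ ≤ ⋯ ≤ Wₙ = ⊤` are encoded with an
index shift, so that `W k` denotes `W_{k-1}`.) -/
theorem strict_compatibility_of_comm_of_coprime_gradedCharpoly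
    {L V V' : Type*} [Field L]
    [AddCommGroup V] [Module L V] [FiniteDimensional L V]
    [AddCommGroup V'] [Module L V'] [FiniteDimensional L V']
    (φ : V →ₗ[L] V) (φ' : V' →ₗ[L] V') (n : ℕ)
    (W : ℕ → Submodule L V) (W' : ℕ → Submodule L V')
    (hbot : W 0 = ⊥) (htop : W (n + 1) = ⊤) (hmono : Monotone W)
    (hbot' : W' 0 = ⊥) (htop' : W' (n + 1) = ⊤) (hmono' : Monotone W')
    (hinv : ∀ k, ∀ x ∈ W k, φ x ∈ W k) (hinv' : ∀ k, ∀ x ∈ W' k, φ' x ∈ W' k)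
    (P P' : ℕ → Polynomial L)
    (hP : ∀ k ≤ n, P k = gradedCharpoly φ (W k) (W (k + 1)) (hinv k) (hinv (k + 1)))
    (hP' : ∀ j ≤ n, P' j = gradedCharpoly φ' (W' j) (W' (j + 1)) (hinv' j) (hinv' (j + 1)))
    (hcop : ∀ k ≤ n, ∀ j ≤ n, k ≠ j → IsCoprime (P k) (P' j))
    (f : V →ₗ[L] V') (hf : f ∘ₗ φ = φ' ∘ₗ f) :
    ∀ k ≤ n, (W (k + 1)).map f = LinearMap.range f ⊓ W' (k + 1) := by
  have hW : ∀ k < n + 1, ∀ x ∈ W (k + 1), Polynomial.aeval φ (P k) x ∈ W k := by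
    intro k hk x hx
    rw [hP k (by lia)]
    exact aeval_gradedCharpoly_mem _ _ hx
  have hW' : ∀ k < n + 1, ∀ x ∈ W' (k + 1), Polynomial.aeval φ' (P' k) x ∈ W' k := by
    intro k hk x hx
    rw [hP' k (by lia)]
    exact aeval_gradedCharpoly_mem _ _ hx
  have hcomm := map_aeval_of_comm (LinearMap.congr_fun hf)
  intro k hk
  have hlow : ∀ x ∈ W (k + 1),
      Polynomial.aeval φ (∏ i ∈ Finset.Ico 0 (k + 1), P i) x = 0 := fun x hx => by
    simpa [hbot] using aeval_prod_Ico_mem (Nat.zero_le _) (fun i hi => hW i (by lia)) hx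
  have hlow' : ∀ y ∈ W' (k + 1),
      Polynomial.aeval φ' (∏ i ∈ Finset.Ico 0 (k + 1), P' i) y = 0 := fun y hy => by
    simpa [hbot'] using aeval_prod_Ico_mem (Nat.zero_le _) (fun i hi => hW' i (by lia)) hy
  have hhigh : ∀ x, Polynomial.aeval φ (∏ i ∈ Finset.Ico (k + 1) (n + 1), P i) x ∈ W (k + 1) :=
    fun x => aeval_prod_Ico_mem (by lia) hW (htop ▸ Submodule.mem_top)
  have hhigh' : ∀ y,
      Polynomial.aeval φ' (∏ i ∈ Finset.Ico (k + 1) (n + 1), P' i) y ∈ W' (k + 1) :=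
    fun y => aeval_prod_Ico_mem (by lia) hW' (htop' ▸ Submodule.mem_top)
  apply le_antisymm
  · rintro _ ⟨x, hx, rfl⟩
    refine ⟨⟨x, rfl⟩, ?_⟩
    obtain ⟨u, v, huv⟩ : IsCoprime (∏ i ∈ Finset.Ico 0 (k + 1), P i)
        (∏ i ∈ Finset.Ico (k + 1) (n + 1), P' i) := by
      refine IsCoprime.prod_left fun i hi => IsCoprime.prod_right fun j hj => ?_
      rw [Finset.mem_Ico] at hi hj
      exact hcop i (by lia) j (by lia) (by lia)
    have hdecomp := congrArg (fun p => Polynomial.aeval φ' p (f x)) huv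
    simp only [map_add, map_mul, map_one, LinearMap.add_apply, Module.End.mul_apply,
      Module.End.one_apply] at hdecomp
    rw [← hcomm (∏ i ∈ Finset.Ico 0 (k + 1), P i), hlow x hx, map_zero, map_zero,
      zero_add] at hdecomp
    exact hdecomp ▸ aeval_mem_of_invariant (hinv' _) v (hhigh' (f x))
  · rintro _ ⟨⟨x, rfl⟩, hy⟩
    obtain ⟨u, v, huv⟩ : IsCoprime (∏ i ∈ Finset.Ico 0 (k + 1), P' i)
        (∏ i ∈ Finset.Ico (k + 1) (n + 1), P i) := by
      refine IsCoprime.prod_left fun i hi => IsCoprime.prod_right fun j hj => ?_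
      rw [Finset.mem_Ico] at hi hj
      exact (hcop j (by lia) i (by lia) (by lia)).symm
    have hdecomp := congrArg (fun p => Polynomial.aeval φ' p (f x)) huv
    simp only [map_add, map_mul, map_one, LinearMap.add_apply, Module.End.mul_apply,
      Module.End.one_apply] at hdecomp
    rw [hlow' _ hy, map_zero, zero_add, ← hcomm, ← hcomm] at hdecomp
    exact ⟨_, aeval_mem_of_invariant (hinv _) v (hhigh x), hdecomp⟩
end
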